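/- arXiv:cond-mat/9503017 — 2 statements merged into one kernel-verified Lean document; each statement's English description precedes it below -/
import Mathlib

section
/- The subgroup G of ℤ⁴⁰ generated by the 40 vectors R^α v₁, R^α v₂, R^α w₁, R^α w₂ (α = 0, …, 9) is a free abelian group of rank 32; in other words, 8 of these 40 vectors are linearly dependent on the others. -/
/-- The 10×10 cyclic-shift permutation matrix `ω`, with `ω α β = 1` iff `β ≡ α + 1 (mod 10)`. -/
def omegaMat : Matrix (Fin 10) (Fin 10) ℤ :=
  Matrix.of fun α β => if β = α + 1 then 1 else 0

/-- The block-diagonal rotation matrix `R = diag(ω, ω, ω, ω) ∈ M₄₀(ℤ)`. -/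
def Rmat : Matrix (Fin 40) (Fin 40) ℤ :=
  Matrix.of fun i j =>
    if i.val / 10 = j.val / 10 then
      omegaMat ⟨i.val % 10, by omega⟩ ⟨j.val % 10, by omega⟩
    else 0

/-- The 4×4 array of 10×10 blocks of the Penrose triangle substitution matrix:
rows of blocks `(ω⁴, ω⁰, 0, ω⁶)`, `(ω⁰, ω⁶, ω⁴, 0)`, `(ω³, 0, ω⁷, 0)`, `(0, ω⁷, 0, ω³)`. -/
def penroseBlocks : Fin 4 → Fin 4 → Matrix (Fin 10) (Fin 10) ℤ :=
  ![![omegaMat ^ 4, omegaMat ^ 0, 0, omegaMat ^ 6],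
    ![omegaMat ^ 0, omegaMat ^ 6, omegaMat ^ 4, 0],
    ![omegaMat ^ 3, 0, omegaMat ^ 7, 0],
    ![0, omegaMat ^ 7, 0, omegaMat ^ 3]]

/-- The Penrose triangle substitution matrix `σ̌ ∈ M₄₀(ℤ)`. -/
def sigmaCheck : Matrix (Fin 40) (Fin 40) ℤ :=
  Matrix.of fun i j =>
    penroseBlocks ⟨i.val / 10, by omega⟩ ⟨j.val / 10, by omega⟩
      ⟨i.val % 10, by omega⟩ ⟨j.val % 10, by omega⟩

/-- The standard basis vectors of `ℤ⁴⁰`, numbered `1`-based: `stdVec i = e_{i+1}`. -/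
def stdVec (i : Fin 40) : Fin 40 → ℤ := Pi.single i 1

/-- `v₁ = e₂₇ − e₃₂`. -/
def pv1 : Fin 40 → ℤ := stdVec 26 - stdVec 31
/-- `v₂ = e₇ − e₁₂`. -/
def pv2 : Fin 40 → ℤ := stdVec 6 - stdVec 11
/-- `w₁ = e₈ − e₁₁ + e₂₉ − e₄₀`. -/
def pw1 : Fin 40 → ℤ := stdVec 7 - stdVec 10 + stdVec 28 - stdVec 39
/-- `w₂ = e₆ − e₁₃ − e₃₀ + e₃₉`. -/
def pw2 : Fin 40 → ℤ := stdVec 5 - stdVec 12 - stdVec 29 + stdVec 38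

/-- The subgroup `G ⊆ ℤ⁴⁰` generated by the 40 vectors
`R^α v₁, R^α v₂, R^α w₁, R^α w₂`, `α = 0, …, 9` (matrices acting on column vectors). -/
def Gsub : AddSubgroup (Fin 40 → ℤ) :=
  AddSubgroup.closure
    {x | ∃ α : Fin 10,
      x = (Rmat ^ (α : ℕ)).mulVec pv1 ∨ x = (Rmat ^ (α : ℕ)).mulVec pv2 ∨
      x = (Rmat ^ (α : ℕ)).mulVec pw1 ∨ x = (Rmat ^ (α : ℕ)).mulVec pw2}

/-- The subgroup `H₁ ⊆ ℤ⁴⁰` generated by the 20 vectors `R^α v₁, R^α v₂`, `α = 0, …, 9`. -/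
def H1sub : AddSubgroup (Fin 40 → ℤ) :=
  AddSubgroup.closure
    {x | ∃ α : Fin 10,
      x = (Rmat ^ (α : ℕ)).mulVec pv1 ∨ x = (Rmat ^ (α : ℕ)).mulVec pv2}

/-- Cyclic rotation of each block of ten indices. -/
def rotIdx (i : Fin 40) : Fin 40 := ⟨10 * (i.val / 10) + (i.val % 10 + 1) % 10, by omega⟩

theorem Rmat_entry : ∀ i j : Fin 40, Rmat i j = if j = rotIdx i then 1 else 0 := by
  intro i j
  have h : ∀ i j : Fin 40, (if i.val / 10 = j.val / 10 then
      (if (⟨j.val % 10, by omega⟩ : Fin 10) = ⟨i.val % 10, by omega⟩ + 1 then 1 else 0)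
    else 0 : ℤ) = if j = rotIdx i then 1 else 0 := by decide +kernel
  exact h i j

theorem Rmat_mulVec (x : Fin 40 → ℤ) : Rmat.mulVec x = fun i => x (rotIdx i) := by
  funext i
  simp [Matrix.mulVec, dotProduct, Rmat_entry]

/-- Rotated vectors. -/
def rotVec (n : ℕ) (x : Fin 40 → ℤ) : Fin 40 → ℤ := fun i => x (rotIdx^[n] i)

theorem Rmat_pow_mulVec (n : ℕ) (x : Fin 40 → ℤ) :
    (Rmat ^ n).mulVec x = rotVec n x := by
  induction n generalizing x with
  | zero => rw [pow_zero, Matrix.one_mulVec]; rfl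
  | succ k ih =>
    rw [pow_succ, ← Matrix.mulVec_mulVec, Rmat_mulVec, ih]
    funext i
    simp only [rotVec, Function.iterate_succ_apply']

/-- The 32 basis vectors: all rotations of `v₁`, `v₂`, eight of `w₁`, four of `w₂`. -/
def basVec (j : Fin 32) : Fin 40 → ℤ :=
  if j.val < 10 then rotVec j.val pv1
  else if j.val < 20 then rotVec (j.val - 10) pv2
  else if j.val < 28 then rotVec (j.val - 20) pw1
  else rotVec (j.val - 28) pw2

/-- Left inverse (up to the factor 1) of the basis matrix. -/
def leftInv : Fin 32 → Fin 40 → ℤ :=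
  ![![0, 0, 0, 0, 0, 0, 0, 0, 0, 0, 0, 0, 0, 0, 0, 0, 0, 0, 0, 0, 0, 0, 0, 0, 0, 0, 0, 0, 0, 0, 0, -1, 0, 0, 0, 0, 0, 0, 0, 0],
  ![0, 0, 0, 0, 0, 0, 0, 0, 0, 0, 0, 0, 0, 0, 0, 0, 0, 0, 0, 0, 0, 0, 0, 0, 0, 0, 0, 0, 0, 0, -1, 0, 0, 0, 0, 0, 0, 0, 0, 0],
  ![0, 1, 0, 0, 0, 0, 0, 0, 0, 1, 0, 0, 0, 0, 1, 0, 1, 0, 0, 0, 0, 0, 0, 0, 1, 0, 0, 0, 0, 0, 0, 0, 0, 0, 0, 0, 0, 0, 0, 0],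
  ![0, 0, -1, 0, -1, 0, -1, 0, 0, 0, 0, -1, 0, 0, 0, 0, 0, -1, 0, -1, 0, 0, 0, 1, 0, 0, 0, 0, 0, 0, 0, 0, 0, 0, 0, 0, 0, 0, 0, 0],
  ![0, 0, 0, 0, 0, 0, 0, 0, 0, 1, 0, 0, 0, 0, 1, 0, 0, 0, 0, 0, 0, 0, 1, 0, 0, 0, 0, 0, 0, 0, 0, 0, 0, 0, 0, 0, 0, 0, 0, 0],
  ![0, 0, 0, 0, 0, 0, 0, 0, 1, 0, 0, 0, 0, 1, 0, 0, 0, 0, 0, 0, 0, 1, 0, 0, 0, 0, 0, 0, 0, 0, 0, 0, 0, 0, 0, 0, 0, 0, 0, 0],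
  ![0, 1, 0, 0, -1, 0, -1, 0, 0, 1, 0, -1, 0, 0, 1, 0, 1, 0, 0, -1, 0, 0, 0, 0, 0, 1, 0, 0, 0, 0, 1, 0, 0, 0, 0, -1, 0, 0, 0, 0],
  ![0, 0, -1, 0, -1, 0, -1, 0, 0, 0, 0, -1, 0, 0, 0, 0, 0, -1, 0, -1, 0, 0, 0, 0, 0, 0, 0, 0, 0, 0, 0, 0, 0, 0, -1, 0, 0, 0, 0, 0],
  ![0, 0, 0, 0, 0, 0, 0, 0, 0, 1, 0, 0, 0, 0, 1, 0, 0, 0, 0, 0, 0, 0, 0, 0, 0, 0, 0, 0, 0, 0, 0, 0, 0, -1, 0, 0, 0, 0, 0, 0],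
  ![0, 0, 0, 0, 0, 0, 0, 0, 1, 0, 0, 0, 0, 1, 0, 0, 0, 0, 0, 0, 0, 0, 0, 0, 0, 0, 0, 0, 0, 0, 0, 0, -1, 0, 0, 0, 0, 0, 0, 0],
  ![0, 1, 0, 0, 0, 0, 0, 0, 0, 0, 0, -1, 0, 0, 0, 0, 1, 0, 0, 0, 0, 0, 0, 0, 1, 0, 0, 0, 1, 0, 0, 0, 0, 1, 0, 0, 0, 0, 0, 1],
  ![0, 1, 0, 0, 0, 0, 0, 0, -1, 1, -1, 0, 0, -1, 1, 0, 1, 0, 0, 0, 0, -1, 0, 0, 1, -1, 0, 0, 0, 0, -1, 0, 0, 0, 0, 0, -1, 0, 0, 1],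
  ![0, 1, 0, 0, 1, 0, 0, 0, 0, 0, 0, 0, 0, 0, 0, 0, 1, 0, 0, 0, 0, 0, 0, 0, 1, -1, 0, 0, 1, 0, -1, 0, 0, 1, 0, 0, 0, 0, 0, 1],
  ![0, 1, 0, 0, 0, 0, 0, 0, 0, 1, 0, 0, 0, 0, 1, 0, 1, 0, -1, 0, 0, 0, 1, 0, 1, 0, 0, 0, 1, 0, 0, 0, 0, 1, 0, 0, 0, 1, 0, 1],
  ![0, 0, 0, 0, 0, 0, 0, 0, 0, 0, 0, 0, 0, 0, 0, 0, 0, -1, 0, 0, 0, 0, 0, 0, 0, -1, 0, 0, 0, 0, -1, 0, 0, 0, 0, 0, 0, 0, 0, 0],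
  ![0, 1, 0, 0, 0, 0, 0, 0, 0, 1, 0, 0, 0, 0, 1, 0, 0, 0, 0, 0, 0, 0, 0, 0, 0, 0, 0, 0, 0, 0, 0, 0, 0, 0, 0, 0, 0, 0, 0, 0],
  ![1, 0, 0, 0, 0, 0, 0, 0, 1, 0, 0, 0, 0, 1, 0, 0, 0, 0, 0, 0, 0, 0, 0, 0, 0, 0, 0, 0, 0, 0, 0, 0, 0, 0, 0, 0, 0, 0, 0, 0],
  ![0, 0, 0, 0, 0, 0, 0, 0, 0, 1, 0, 0, 0, 0, 0, 0, 0, 0, 0, 0, 0, 0, 0, 0, 0, 0, 0, 0, 0, 0, 0, 0, 0, 0, 0, 0, 0, 0, 0, 0],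
  ![0, 0, 0, 0, 0, 0, 0, 0, 1, 0, 0, 0, 0, 0, 0, 0, 0, 0, 0, 0, 0, 0, 0, 0, 0, 0, 0, 0, 0, 0, 0, 0, 0, 0, 0, 0, 0, 0, 0, 0],
  ![0, 1, 1, 0, 1, 0, 0, 0, 0, 0, 0, 0, -1, 0, 0, 0, 1, 1, 0, 1, 0, 0, 0, -1, 1, 0, 0, 0, 1, 0, 0, 0, 0, 1, 0, 0, 0, 0, -1, 1],
  ![0, -1, 0, 0, 0, 0, 0, 0, 0, -1, 0, 0, 0, 0, -1, 0, -1, 0, 0, 0, 0, 0, 0, 0, -1, 0, 0, 0, 0, 0, 0, 0, 0, 0, 0, 0, 0, 0, 0, -1],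
  ![0, -1, 0, 0, 0, 0, 1, 0, 0, 0, 0, 1, 0, 0, 0, 0, -1, 0, 0, 0, 0, 0, 0, 0, -1, 0, 0, 0, -1, 0, 0, 0, 0, -1, 0, 0, 0, 0, 0, -1],
  ![0, -1, 0, 0, 0, 0, 0, 0, 0, -1, 0, 0, 0, 0, -1, 0, -1, 0, 0, 0, 0, 0, -1, 0, -1, 0, 0, 0, -1, 0, 0, 0, 0, -1, 0, 0, 0, -1, 0, -1],
  ![0, 0, 0, 0, 0, 0, 0, 0, 0, 0, 0, 0, 0, 0, 0, 0, 0, 0, 0, 0, 0, 0, 0, 0, 0, 1, 0, 0, 0, 0, 1, 0, 0, 0, 0, 0, 0, 0, 0, 0],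
  ![0, -1, 0, 0, 0, 0, 0, 0, 0, -1, 0, 0, 0, 0, -1, 0, -1, 0, 0, 0, 0, 0, 0, 0, 0, 0, 0, 0, 0, 0, 0, 0, 0, 0, 0, 0, 0, 0, 0, 0],
  ![0, 0, 1, 0, 1, 0, 1, 0, 0, 0, 0, 1, 0, 0, 0, 0, 0, 1, 0, 1, 0, 0, 0, 0, 0, 0, 0, 0, 0, 0, 0, 0, 0, 0, 0, 0, 0, 0, 0, 0],
  ![0, 0, 0, 0, 0, 0, 0, 0, 0, -1, 0, 0, 0, 0, -1, 0, 0, 0, 0, 0, 0, 0, 0, 0, 0, 0, 0, 0, 0, 0, 0, 0, 0, 0, 0, 0, 0, 0, 0, 0],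
  ![0, 0, 0, 0, 0, 0, 0, 0, -1, 0, 0, 0, 0, -1, 0, 0, 0, 0, 0, 0, 0, 0, 0, 0, 0, 0, 0, 0, 0, 0, 0, 0, 0, 0, 0, 0, 0, 0, 0, 0],
  ![0, -1, -1, 0, -1, 0, 0, 0, 0, 0, 0, 0, 0, 0, 0, 0, -1, -1, 0, -1, 0, 0, 0, 1, -1, 0, 0, 0, -1, 0, 0, 0, 0, -1, 0, 0, 0, 0, 1, -1],
  ![0, -1, 0, 0, 0, 0, 0, 0, 0, 0, 0, 0, 0, 0, 0, 0, -1, 0, 0, 0, 0, 0, 0, 0, -1, 0, 0, 0, -1, 0, 0, 0, 0, -1, 0, 0, 0, 0, 0, -1],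
  ![0, 0, 0, 0, 0, 0, 0, 0, 1, 0, 0, 0, 0, 1, 0, 0, 0, 0, 0, 0, 0, 1, 0, 0, 0, 1, 0, 0, 0, 0, 1, 0, 0, 0, 0, 0, 1, 0, 0, 0],
  ![0, 0, 0, 0, -1, 0, -1, 0, 0, 0, 0, -1, 0, 0, 0, 0, 0, 0, 0, -1, 0, 0, 0, 0, 0, 1, 0, 0, 0, 0, 1, 0, 0, 0, 0, 0, 0, 0, 0, 0]]

/-- Coefficients of the eight redundant generators. -/
def redCoef : Fin 8 → Fin 32 → ℤ :=
  ![![1, 0, 1, 0, 1, 0, 1, 0, 1, 0, 0, 1, 0, 1, 0, 1, 0, 1, 0, 1, -1, 0, -1, 0, -1, 0, -1, 0, 0, 0, 0, 0],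
  ![0, 1, 0, 1, 0, 1, 0, 1, 0, 1, 1, 0, 1, 0, 1, 0, 1, 0, 1, 0, 0, -1, 0, -1, 0, -1, 0, -1, 0, 0, 0, 0],
  ![0, 0, 1, 0, 0, 0, 0, -1, 0, 0, 1, 2, 2, 2, 1, 1, 0, 0, 0, 1, -1, -1, -1, -1, -1, 0, 0, 0, -1, -1, -1, -1],
  ![0, 0, -1, 1, 0, 0, 0, 1, -1, 0, 0, -1, 0, 0, 1, 0, 1, 0, 0, -1, 1, 0, 0, 0, 0, -1, 0, 0, 1, 0, 0, 0],
  ![0, 0, 0, -1, 1, 0, 0, 0, 1, -1, -1, 0, -1, 0, 0, 1, 0, 1, 0, 0, 0, 1, 0, 0, 0, 0, -1, 0, 0, 1, 0, 0],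
  ![-1, 0, 0, 0, -1, 1, 0, 0, 0, 1, 0, -1, 0, -1, 0, 0, 1, 0, 1, 0, 0, 0, 1, 0, 0, 0, 0, -1, 0, 0, 1, 0],
  ![0, -1, -1, 0, -1, -1, 0, 0, -1, 0, 0, -1, -1, -1, -1, -1, 0, 0, 0, 0, 1, 0, 1, 1, 1, 0, 1, 0, 0, 0, 0, 1],
  ![0, 0, 0, -1, 0, -1, -1, -1, 0, -1, 1, 2, 1, 1, 0, 0, -1, 0, 0, 1, -1, 0, -1, 0, 0, 1, 0, 1, -1, -1, -1, -1]]

theorem leftInv_spec : ∀ j k : Fin 32,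
    ∑ i, leftInv j i * basVec k i = if j = k then 1 else 0 := by
  decide +kernel

theorem red_w1 : ∀ (a : Fin 2) (i : Fin 40),
    ∑ j, redCoef (Fin.castLE (by omega) a) j * basVec j i = rotVec (8 + a.val) pw1 i := by
  decide +kernel

theorem red_w2 : ∀ (a : Fin 6) (i : Fin 40),
    ∑ j, redCoef (Fin.natAdd 2 a) j * basVec j i = rotVec (4 + a.val) pw2 i := by
  decide +kernel

theorem basVec_li : LinearIndependent ℤ basVec := by
  rw [Fintype.linearIndependent_iff]
  intro c hc j
  have h : ∑ i, leftInv j i * (∑ k, c k • basVec k) i = 0 := by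
    rw [hc]; simp
  simp only [Finset.sum_apply, Pi.smul_apply, smul_eq_mul, Finset.mul_sum] at h
  rw [Finset.sum_comm] at h
  have h2 : ∀ k, ∑ i, leftInv j i * (c k * basVec k i) = c k * (if j = k then 1 else 0) := by
    intro k
    rw [← leftInv_spec j k, Finset.mul_sum]
    exact Finset.sum_congr rfl fun i _ => by ring
  simp only [h2] at h
  simpa using h

theorem mem_of_coef (c : Fin 32 → ℤ) (x : Fin 40 → ℤ)
    (h : ∀ i, ∑ j, c j * basVec j i = x i) :
    x ∈ Submodule.span ℤ (Set.range basVec) := by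
  have : x = ∑ j, c j • basVec j := by
    funext i
    simp [← h i]
  rw [this]
  exact Submodule.sum_mem _ fun j _ =>
    Submodule.smul_mem _ _ (Submodule.subset_span ⟨j, rfl⟩)

theorem Gsub_eq : Gsub = (Submodule.span ℤ (Set.range basVec)).toAddSubgroup := by
  apply le_antisymm
  · unfold Gsub
    rw [AddSubgroup.closure_le]
    rintro x ⟨α, h⟩
    simp only [Rmat_pow_mulVec] at h
    change x ∈ Submodule.span ℤ (Set.range basVec)
    have hα := α.isLt
    rcases h with rfl | rfl | rfl | rfl
    · refine Submodule.subset_span ⟨⟨α.val, by omega⟩, ?_⟩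
      simp [basVec, hα]
    · refine Submodule.subset_span ⟨⟨10 + α.val, by omega⟩, ?_⟩
      have h2 : 10 + α.val < 20 := by omega
      simp [basVec, h2]
    · by_cases h8 : α.val < 8
      · refine Submodule.subset_span ⟨⟨20 + α.val, by omega⟩, ?_⟩
        have h1 : ¬ 20 + α.val < 10 := by omega
        have h2 : 20 + α.val < 28 := by omega
        simp [basVec, h1, h2]
      · have := mem_of_coef _ _ (red_w1 ⟨α.val - 8, by omega⟩)
        have e : 8 + (α.val - 8) = α.val := by omega
        simpa only [e] using this
    · by_cases h4 : α.val < 4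
      · refine Submodule.subset_span ⟨⟨28 + α.val, by omega⟩, ?_⟩
        have h1 : ¬ 28 + α.val < 10 := by omega
        have h2 : ¬ 28 + α.val < 20 := by omega
        simp [basVec, h1, h2]
      · have := mem_of_coef _ _ (red_w2 ⟨α.val - 4, by omega⟩)
        have e : 4 + (α.val - 4) = α.val := by omega
        simpa only [e] using this
  · have key : Submodule.span ℤ (Set.range basVec) ≤ AddSubgroup.toIntSubmodule Gsub := by
      rw [Submodule.span_le]
      rintro _ ⟨j, rfl⟩
      change basVec j ∈ Gsub
      have hj := j.isLt
      apply AddSubgroup.subset_closure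
      simp only [Rmat_pow_mulVec, Set.mem_ofPred_eq]
      unfold basVec
      split_ifs with h1 h2 h3
      · exact ⟨⟨j.val, by omega⟩, Or.inl rfl⟩
      · exact ⟨⟨j.val - 10, by omega⟩, Or.inr (Or.inl rfl)⟩
      · exact ⟨⟨j.val - 20, by omega⟩, Or.inr (Or.inr (Or.inl rfl))⟩
      · exact ⟨⟨j.val - 28, by omega⟩, Or.inr (Or.inr (Or.inr rfl))⟩
    exact key

/-- The subgroup `G ⊆ ℤ⁴⁰` generated by the 40 vectors
`R^α v₁, R^α v₂, R^α w₁, R^α w₂` (`α = 0, …, 9`) is free abelian of rank 32. -/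
theorem Gsub_free_rank_32 : Nonempty (↥Gsub ≃+ (Fin 32 → ℤ)) := by
  rw [Gsub_eq]
  exact ⟨((Module.Basis.span basVec_li).equivFun).toAddEquiv⟩
end

section
/- The subgroup G of ℤ⁴⁰ is invariant under the substitution matrix σ = σ̌⁴: multiplication by σ̌⁴ maps G onto G, i.e. σ̌⁴ · G = G. -/
/-- Shift by `k` within each block of ten indices. -/
def shIdx (b k : ℕ) (hb : b < 4) (i : Fin 40) : Fin 40 :=
  ⟨10 * b + (i.val % 10 + k) % 10, by omega⟩

/-- First nonzero column of `sigmaCheck` in row `i`. -/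
def colA (i : Fin 40) : Fin 40 :=
  if i.val < 10 then shIdx 0 4 (by omega) i else if i.val < 20 then shIdx 0 0 (by omega) i
  else if i.val < 30 then shIdx 0 3 (by omega) i else shIdx 1 7 (by omega) i

def colB (i : Fin 40) : Fin 40 :=
  if i.val < 10 then shIdx 1 0 (by omega) i else if i.val < 20 then shIdx 1 6 (by omega) i
  else if i.val < 30 then shIdx 2 7 (by omega) i else shIdx 3 3 (by omega) i

def colC (i : Fin 40) : Fin 40 :=
  if i.val < 10 then shIdx 3 6 (by omega) i else shIdx 2 4 (by omega) i

def wtC (i : Fin 40) : ℤ := if i.val < 20 then 1 else 0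

lemma omega_pow (k : ℕ) : omegaMat ^ k =
    Matrix.of fun α β : Fin 10 => if β = α + Fin.ofNat 10 k then (1 : ℤ) else 0 := by
  induction k with
  | zero =>
    ext α β
    simp [Matrix.one_apply, eq_comm]
  | succ n ih =>
    have hk : Fin.ofNat 10 (n + 1) = Fin.ofNat 10 n + 1 := by
      apply Fin.ext
      simp [Fin.ofNat, Fin.val_add]
    rw [pow_succ, ih, hk]
    ext α β
    rw [Matrix.mul_apply, Finset.sum_eq_single (α + Fin.ofNat 10 n)]
    · simp [omegaMat, add_assoc]
    · intro b _ hb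
      simp only [Matrix.of_apply, if_neg hb, zero_mul]
    · intro h
      exact absurd (Finset.mem_univ _) h

lemma Rmat_apply : ∀ i j : Fin 40, Rmat i j = if j = rotIdx i then (1 : ℤ) else 0 := by
  simp only [Rmat, omegaMat, Matrix.of_apply]
  decide +kernel

def blk : Fin 4 → Fin 4 → Fin 10 → Fin 10 → ℤ :=
  let o (k : ℕ) : Fin 10 → Fin 10 → ℤ := fun α β => if β = α + Fin.ofNat 10 k then (1 : ℤ) else 0
  ![![o 4, o 0, 0, o 6], ![o 0, o 6, o 4, 0], ![o 3, 0, o 7, 0], ![0, o 7, 0, o 3]]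

lemma blk_eq : ∀ a b α β, penroseBlocks a b α β = blk a b α β := by
  intro a b α β
  unfold penroseBlocks
  simp only [omega_pow]
  fin_cases a <;> fin_cases b <;> rfl

lemma blk_apply : ∀ i j : Fin 40, blk ⟨i.val / 10, by omega⟩ ⟨j.val / 10, by omega⟩
      ⟨i.val % 10, by omega⟩ ⟨j.val % 10, by omega⟩ =
    (if j = colA i then 1 else 0) + (if j = colB i then 1 else 0) +
      (if j = colC i then wtC i else 0) := by
  decide +kernel

lemma sigma_apply (i j : Fin 40) : sigmaCheck i j =
    (if j = colA i then 1 else 0) + (if j = colB i then 1 else 0) +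
      (if j = colC i then wtC i else 0) := by
  rw [← blk_apply, ← blk_eq]; rfl

lemma R_mulVec (f : Fin 40 → ℤ) : Rmat.mulVec f = fun i => f (rotIdx i) := by
  ext i
  simp [Matrix.mulVec, dotProduct, Rmat_apply]

lemma S_mulVec (f : Fin 40 → ℤ) :
    sigmaCheck.mulVec f = fun i => f (colA i) + f (colB i) + wtC i * f (colC i) := by
  ext i
  simp [Matrix.mulVec, dotProduct, sigma_apply, add_mul, Finset.sum_add_distrib]

lemma mat_ext {A B : Matrix (Fin 40) (Fin 40) ℤ} (h : ∀ f, A.mulVec f = B.mulVec f) : A = B :=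
  Matrix.mulVec_injective (funext h)

lemma R_ten : Rmat ^ 10 = 1 := by
  apply mat_ext
  intro f
  have h : ∀ i, rotIdx (rotIdx (rotIdx (rotIdx (rotIdx (rotIdx (rotIdx (rotIdx (rotIdx
    (rotIdx i))))))))) = i := by decide +kernel
  simp only [pow_succ, pow_zero, ← Matrix.mulVec_mulVec, Matrix.one_mulVec, R_mulVec, h]

lemma R5_mulVec (f : Fin 40 → ℤ) : (Rmat ^ 5).mulVec f =
    fun i => f (rotIdx (rotIdx (rotIdx (rotIdx (rotIdx i))))) := by
  simp only [pow_succ, pow_zero, ← Matrix.mulVec_mulVec, Matrix.one_mulVec, R_mulVec]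

lemma RS_comm : Commute sigmaCheck Rmat := by
  apply mat_ext
  intro f
  have hA : ∀ i, rotIdx (colA i) = colA (rotIdx i) := by decide +kernel
  have hB : ∀ i, rotIdx (colB i) = colB (rotIdx i) := by decide +kernel
  have hC : ∀ i, rotIdx (colC i) = colC (rotIdx i) := by decide +kernel
  have hw : ∀ i, wtC (rotIdx i) = wtC i := by decide +kernel
  simp only [← Matrix.mulVec_mulVec, R_mulVec, S_mulVec, hA, hB, hC, hw]

lemma S_v1 : sigmaCheck.mulVec pv1 = - pw2 := by
  rw [S_mulVec]; decide +kernel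

lemma S_v2 : sigmaCheck.mulVec pv2 = (Rmat ^ 5).mulVec (pw1 - pv2) := by
  rw [S_mulVec, R5_mulVec]; decide +kernel

lemma S_w1 : sigmaCheck.mulVec pw1 = (Rmat ^ 5).mulVec (pv1 - pw2) := by
  rw [S_mulVec, R5_mulVec]; decide +kernel

lemma S_w2 : sigmaCheck.mulVec pw2 = (Rmat ^ 5).mulVec pv2 := by
  rw [S_mulVec, R5_mulVec]; decide +kernel

lemma gen_mem (n : ℕ) : (Rmat ^ n).mulVec pv1 ∈ Gsub ∧ (Rmat ^ n).mulVec pv2 ∈ Gsub ∧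
    (Rmat ^ n).mulVec pw1 ∈ Gsub ∧ (Rmat ^ n).mulVec pw2 ∈ Gsub := by
  rw [pow_eq_pow_mod n R_ten]
  have h : n % 10 < 10 := Nat.mod_lt _ (by norm_num)
  refine ⟨?_, ?_, ?_, ?_⟩ <;> refine AddSubgroup.subset_closure ⟨⟨n % 10, h⟩, ?_⟩ <;> simp

lemma S_R (n : ℕ) (f : Fin 40 → ℤ) :
    sigmaCheck.mulVec ((Rmat ^ n).mulVec f) = (Rmat ^ n).mulVec (sigmaCheck.mulVec f) := by
  rw [Matrix.mulVec_mulVec, Matrix.mulVec_mulVec, (RS_comm.pow_right n).eq]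

lemma R_R (m n : ℕ) (f : Fin 40 → ℤ) :
    (Rmat ^ m).mulVec ((Rmat ^ n).mulVec f) = (Rmat ^ (m + n)).mulVec f := by
  rw [Matrix.mulVec_mulVec, pow_add]

lemma R_add_ten (n : ℕ) : Rmat ^ (n + 5 + 5) = Rmat ^ n := by
  rw [add_assoc, pow_add, R_ten, mul_one]

lemma map_sigma : AddSubgroup.map sigmaCheck.mulVecLin.toAddMonoidHom Gsub = Gsub := by
  apply le_antisymm
  · rw [AddSubgroup.map_le_iff_le_comap]
    conv_lhs => rw [Gsub]
    rw [AddSubgroup.closure_le]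
    rintro x ⟨α, rfl | rfl | rfl | rfl⟩
    · change sigmaCheck.mulVec _ ∈ Gsub
      rw [S_R, S_v1, Matrix.mulVec_neg]
      exact neg_mem (gen_mem _).2.2.2
    · change sigmaCheck.mulVec _ ∈ Gsub
      rw [S_R, S_v2, R_R, Matrix.mulVec_sub]
      exact sub_mem (gen_mem _).2.2.1 (gen_mem _).2.1
    · change sigmaCheck.mulVec _ ∈ Gsub
      rw [S_R, S_w1, R_R, Matrix.mulVec_sub]
      exact sub_mem (gen_mem _).1 (gen_mem _).2.2.2
    · change sigmaCheck.mulVec _ ∈ Gsub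
      rw [S_R, S_w2, R_R]
      exact (gen_mem _).2.1
  · conv_lhs => rw [Gsub]
    rw [AddSubgroup.closure_le]
    rintro x ⟨α, rfl | rfl | rfl | rfl⟩
    · refine ⟨(Rmat ^ (α.val + 5)).mulVec pw1 - (Rmat ^ α.val).mulVec pv1,
        sub_mem (gen_mem _).2.2.1 (gen_mem _).1, ?_⟩
      change sigmaCheck.mulVec _ = _
      rw [Matrix.mulVec_sub, S_R, S_R, S_w1, S_v1, R_R, R_add_ten, Matrix.mulVec_sub,
        Matrix.mulVec_neg]
      abel
    · refine ⟨(Rmat ^ (α.val + 5)).mulVec pw2, (gen_mem _).2.2.2, ?_⟩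
      change sigmaCheck.mulVec _ = _
      rw [S_R, S_w2, R_R, R_add_ten]
    · refine ⟨(Rmat ^ (α.val + 5)).mulVec pv2 + (Rmat ^ (α.val + 5)).mulVec pw2,
        add_mem (gen_mem _).2.1 (gen_mem _).2.2.2, ?_⟩
      change sigmaCheck.mulVec _ = _
      rw [Matrix.mulVec_add, S_R, S_R, S_w2, S_v2, R_R, R_R, R_add_ten, Matrix.mulVec_sub]
      abel
    · refine ⟨-(Rmat ^ α.val).mulVec pv1, neg_mem (gen_mem _).1, ?_⟩
      change sigmaCheck.mulVec _ = _
      rw [Matrix.mulVec_neg, S_R, S_v1, Matrix.mulVec_neg, neg_neg]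

/-- The subgroup `G` is invariant under the substitution matrix
`σ = σ̌⁴`: multiplication by `σ̌⁴` maps `G` onto `G`. -/
theorem sigma_maps_Gsub_onto_Gsub :
    AddSubgroup.map ((sigmaCheck ^ 4).mulVecLin).toAddMonoidHom Gsub = Gsub := by
  have key : ∀ n : ℕ,
      AddSubgroup.map ((sigmaCheck ^ n).mulVecLin).toAddMonoidHom Gsub = Gsub := by
    intro n
    induction n with
    | zero =>
      ext x
      simp [AddSubgroup.mem_map]
    | succ n ih =>
      have h : ((sigmaCheck ^ (n + 1)).mulVecLin).toAddMonoidHom =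
          ((sigmaCheck ^ n).mulVecLin).toAddMonoidHom.comp
            sigmaCheck.mulVecLin.toAddMonoidHom := by
        rw [pow_succ, Matrix.mulVecLin_mul]
        rfl
      rw [h, ← AddSubgroup.map_map, map_sigma, ih]
  exact key 4
end
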